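/- Fix integers M ≥ 1, K ≥ 1 and a real threshold t > 0. For ḡ > 0 define p(ḡ) = 1 − ( 1 − γ(K, t/ḡ)/Γ(K) )^M, where γ(K, x)/Γ(K) is the normalized lower incomplete gamma function. Then lim_{ḡ → ∞} ḡ^K · p(ḡ) = M t^K / ( K Γ(K) ). Equivalently, p(ḡ) is asymptotically equal to (G_c ḡ)^{−K} as ḡ → ∞, where the coding gain is G_c = ( K Γ(K) / ( M t^K ) )^{1/K} and the diversity order is K. -/

import Mathlib

open MeasureTheory Filter

/-- The lower incomplete gamma function `γ(K, x) = ∫_0^x u^(K-1) e^(-u) du`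
for a natural shape parameter `K ≥ 1`. -/
noncomputable def lowerIncGamma (K : ℕ) (x : ℝ) : ℝ :=
  ∫ u in (0 : ℝ)..x, u ^ (K - 1) * Real.exp (-u)

lemma lowerIncGamma_le {K : ℕ} (hK : 1 ≤ K) {x : ℝ} (hx : 0 ≤ x) :
    lowerIncGamma K x ≤ x ^ K / K := by
  have h : ∫ u in (0 : ℝ)..x, u ^ (K - 1) = x ^ K / K := by
    obtain ⟨k, rfl⟩ := Nat.exists_eq_add_of_le' hK
    simp [integral_pow]
  rw [← h]
  refine intervalIntegral.integral_mono_on hx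
    (Continuous.intervalIntegrable (by fun_prop) _ _)
    (Continuous.intervalIntegrable (by fun_prop) _ _) fun u hu => ?_
  exact mul_le_of_le_one_right (pow_nonneg hu.1 _) (Real.exp_le_one_iff.2 (neg_nonpos.2 hu.1))

lemma le_lowerIncGamma {K : ℕ} (hK : 1 ≤ K) {x : ℝ} (hx : 0 ≤ x) :
    x ^ K / K * Real.exp (-x) ≤ lowerIncGamma K x := by
  have h : ∫ u in (0 : ℝ)..x, u ^ (K - 1) * Real.exp (-x) = x ^ K / K * Real.exp (-x) := by
    obtain ⟨k, rfl⟩ := Nat.exists_eq_add_of_le' hK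
    simp [integral_pow]
  rw [← h]
  refine intervalIntegral.integral_mono_on hx
    (Continuous.intervalIntegrable (by fun_prop) _ _)
    (Continuous.intervalIntegrable (by fun_prop) _ _) fun u hu => ?_
  exact mul_le_mul_of_nonneg_left (Real.exp_le_exp.2 (neg_le_neg hu.2)) (pow_nonneg hu.1 _)

lemma tendsto_pow_mul_lowerIncGamma_div {K : ℕ} (hK : 1 ≤ K) {t : ℝ} (ht : 0 < t) :
    Tendsto (fun g : ℝ => g ^ K * lowerIncGamma K (t / g)) atTop (nhds (t ^ K / K)) := by
  have hlow : Tendsto (fun g : ℝ => t ^ K / K * Real.exp (-(t / g))) atTop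
      (nhds (t ^ K / K)) := by
    have h0 : Tendsto (fun g : ℝ => t / g) atTop (nhds 0) := tendsto_const_nhds.div_atTop tendsto_id
    simpa using (h0.neg.rexp).const_mul (t ^ K / K)
  have hscale : ∀ {g : ℝ}, 0 < g → g ^ K * ((t / g) ^ K / K) = t ^ K / K := fun hg => by
    rw [div_pow]
    field_simp
  refine tendsto_of_tendsto_of_tendsto_of_le_of_le' hlow tendsto_const_nhds ?_ ?_
  · filter_upwards [eventually_gt_atTop 0] with g hg
    rw [← hscale hg, mul_assoc]
    exact mul_le_mul_of_nonneg_left (le_lowerIncGamma hK (by positivity)) (by positivity)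
  · filter_upwards [eventually_gt_atTop 0] with g hg
    rw [← hscale hg]
    exact mul_le_mul_of_nonneg_left (lowerIncGamma_le hK (by positivity)) (by positivity)

lemma tendsto_mul_one_sub_one_sub_pow {α : Type*} {l : Filter α} {a y : α → ℝ} {c : ℝ} (M : ℕ)
    (hay : Tendsto (fun x => a x * y x) l (nhds c)) (hy : Tendsto y l (nhds 0)) :
    Tendsto (fun x => a x * (1 - (1 - y x) ^ M)) l (nhds (M * c)) := by
  have hsum : Tendsto (fun x => ∑ i ∈ Finset.range M, (1 - y x) ^ i) l (nhds (M : ℝ)) := by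
    have := tendsto_finsetSum (Finset.range M) fun i _ => (hy.const_sub 1).pow i
    simpa using this
  rw [mul_comm]
  refine (hay.mul hsum).congr fun x => ?_
  rw [← mul_neg_geom_sum]
  ring

/-- Corollary 2 of the paper.  For the exact outage probability
`p(ḡ) = 1 - (1 - γ(K, t/ḡ)/Γ(K))^M`, one has `ḡ^K p(ḡ) → M t^K/(K Γ(K))` as
`ḡ → ∞`; equivalently `p(ḡ)` is asymptotic to `(G_c ḡ)^{-K}` with coding gain
`G_c = (K Γ(K)/(M t^K))^{1/K}` and diversity order `K`. -/
theorem outage_high_snr_asymptotics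
    (M K : ℕ) (hM : 1 ≤ M) (hK : 1 ≤ K) (t : ℝ) (ht : 0 < t)
    (Gc : ℝ) (hGc : Gc = ((K : ℝ) * Real.Gamma K / (M * t ^ K)) ^ ((1 : ℝ) / K)) :
    Tendsto (fun g : ℝ =>
        g ^ K * (1 - (1 - lowerIncGamma K (t / g) / Real.Gamma K) ^ M))
      atTop (nhds ((M : ℝ) * t ^ K / (K * Real.Gamma K)))
    ∧ Tendsto (fun g : ℝ =>
        (1 - (1 - lowerIncGamma K (t / g) / Real.Gamma K) ^ M) * (Gc * g) ^ K)
      atTop (nhds 1) := by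
  have hK0 : K ≠ 0 := Nat.one_le_iff_ne_zero.1 hK
  have hKpos : (0 : ℝ) < K := by exact_mod_cast hK
  have hMpos : (0 : ℝ) < M := by exact_mod_cast hM
  have hΓ : 0 < Real.Gamma K := Real.Gamma_pos_of_pos hKpos
  have hscaled : Tendsto (fun g : ℝ => g ^ K * (lowerIncGamma K (t / g) / Real.Gamma K)) atTop
      (nhds (t ^ K / K / Real.Gamma K)) := by
    simpa only [mul_div_assoc] using
      (tendsto_pow_mul_lowerIncGamma_div hK ht).div_const (Real.Gamma K)
  have hzero : Tendsto (fun g : ℝ => lowerIncGamma K (t / g) / Real.Gamma K) atTop (nhds 0) := by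
    refine (hscaled.div_atTop (tendsto_pow_atTop hK0)).congr' ?_
    filter_upwards [eventually_gt_atTop 0] with g hg
    field_simp
  have hmain : Tendsto (fun g : ℝ =>
      g ^ K * (1 - (1 - lowerIncGamma K (t / g) / Real.Gamma K) ^ M))
      atTop (nhds ((M : ℝ) * t ^ K / (K * Real.Gamma K))) := by
    convert tendsto_mul_one_sub_one_sub_pow M hscaled hzero using 2
    field_simp
  refine ⟨hmain, ?_⟩
  have hGcK : Gc ^ K = (K : ℝ) * Real.Gamma K / (M * t ^ K) := by
    rw [hGc, one_div, Real.rpow_inv_natCast_pow (by positivity) hK0]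
  convert hmain.const_mul (Gc ^ K) using 2
  · ring
  · rw [hGcK]
    field_simp
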